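/- arXiv:1507.04615 — 2 statements merged into one kernel-verified Lean document; each statement's English description precedes it below -/
import Mathlib

section
/- Let H be a complex Hilbert space, V a balanced set of unit vectors of H that separates points of H, K the norm-closed convex hull in B(H)_* of {ω_{ξ,η} : ξ, η ∈ V}, and A := K(H) + ℂ·1 the unitization of the compact operators. Define E(ψ) := sup{|ψ(x)| : x ∈ A, ‖x‖_K ≤ 1}. Then for every normal state φ on B(H) the following are equivalent: (i) φ belongs to the norm-closed convex hull of {ω_ξ : ξ ∈ V}; (ii) E(φ) = 1; (iii) q_K(φ) = 1. -/
noncomputable section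

open scoped InnerProductSpace ENNReal Pointwise

/-- The vector functional `ω_{ξ,η}` on `B(H)` given by `x ↦ ⟨xξ, η⟩`
(linear in `x`; in Mathlib's convention this is `⟪η, x ξ⟫_ℂ`). -/
def omegaFunctional {H : Type*} [NormedAddCommGroup H] [InnerProductSpace ℂ H]
    (ξ η : H) : (H →L[ℂ] H) →L[ℂ] ℂ :=
  (innerSL ℂ η).comp (ContinuousLinearMap.apply ℂ H ξ)

/-- A continuous linear functional on `B(H)` is *normal* if it lies in the norm closure of the
linear span of the vector functionals (this is the predual `B(H)_*`, i.e. the trace-class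
induced functionals). -/
def IsNormalFunctional {H : Type*} [NormedAddCommGroup H] [InnerProductSpace ℂ H]
    (ψ : (H →L[ℂ] H) →L[ℂ] ℂ) : Prop :=
  ψ ∈ closure (Submodule.span ℂ {φ : (H →L[ℂ] H) →L[ℂ] ℂ | ∃ ξ η : H, φ = omegaFunctional ξ η} :
    Set ((H →L[ℂ] H) →L[ℂ] ℂ))

/-- A *normal state* on `B(H)`: a positive normal functional of norm one. -/
def IsNormalState {H : Type*} [NormedAddCommGroup H] [InnerProductSpace ℂ H] [CompleteSpace H]
    (φ : (H →L[ℂ] H) →L[ℂ] ℂ) : Prop :=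
  IsNormalFunctional φ ∧ ‖φ‖ = 1 ∧
    ∀ x : H →L[ℂ] H, x.IsPositive → 0 ≤ (φ x).re ∧ (φ x).im = 0

/-- `‖x‖_K := sup {|ψ(x)| : ψ ∈ K}`. -/
def normK {H : Type*} [NormedAddCommGroup H] [InnerProductSpace ℂ H]
    (K : Set ((H →L[ℂ] H) →L[ℂ] ℂ)) (x : H →L[ℂ] H) : ℝ :=
  sSup ((fun ψ : (H →L[ℂ] H) →L[ℂ] ℂ => ‖ψ x‖) '' K)

/-- The Minkowski functional `q_K(ψ) := inf {α ≥ 0 : ψ ∈ αK}`, with value `∞` if no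
such `α` exists. -/
def qK {H : Type*} [NormedAddCommGroup H] [InnerProductSpace ℂ H]
    (K : Set ((H →L[ℂ] H) →L[ℂ] ℂ)) (ψ : (H →L[ℂ] H) →L[ℂ] ℂ) : ℝ≥0∞ :=
  sInf {c : ℝ≥0∞ | ∃ r : ℝ, 0 ≤ r ∧ c = ENNReal.ofReal r ∧ ψ ∈ r • K}


/-- A bounded complex-linear functional on the dual of a finite-dimensional space is evaluation
at a point. -/
theorem exists_eval_eq_of_finiteDimensional {W : Type*} [NormedAddCommGroup W] [NormedSpace ℂ W]
    [FiniteDimensional ℂ W] (f : StrongDual ℂ (StrongDual ℂ W)) :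
    ∃ w : W, ∀ g : StrongDual ℂ W, f g = g w := by
  have hdim : ∀ (Y : Type _) [NormedAddCommGroup Y] [NormedSpace ℂ Y] [FiniteDimensional ℂ Y],
      Module.finrank ℂ (StrongDual ℂ Y) = Module.finrank ℂ Y := fun Y _ _ _ =>
    ((LinearMap.toContinuousLinearMap (𝕜 := ℂ) (E := Y) (F' := ℂ)).finrank_eq).symm.trans
      Subspace.dual_finrank_eq
  let J : W →ₗ[ℂ] StrongDual ℂ (StrongDual ℂ W) :=
    (NormedSpace.inclusionInDoubleDual ℂ W).toLinearMap
  have hinj : Function.Injective J :=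
    (NormedSpace.inclusionInDoubleDualLi (𝕜 := ℂ) (E := W)).injective
  have hsurj : Function.Surjective J :=
    (LinearMap.injective_iff_surjective_of_finrank_eq_finrank
      ((hdim (StrongDual ℂ W)).trans (hdim W)).symm).1 hinj
  obtain ⟨w, rfl⟩ := hsurj f
  exact ⟨w, fun g => NormedSpace.dual_def ℂ W w g⟩

theorem mem_closure_strongDual_iff {X : Type*} [SeminormedAddCommGroup X] [NormedSpace ℂ X]
    {S : Set (StrongDual ℂ X)} {φ : StrongDual ℂ X} :
    φ ∈ closure S ↔ ∀ ε > 0, ∃ ψ ∈ S, ‖φ - ψ‖ < ε :=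
  (Metric.mem_closure_iff (α := StrongDual ℂ X)).trans
    (by simp only [← dist_eq_norm (E := StrongDual ℂ X)])

/-- If `φ` is dominated on a finite-dimensional subspace `W` by the support function of a
balanced set `G` of functionals, then on `W` it is uniformly approximated by convex
combinations of elements of `G`. -/
theorem exists_mem_convexHull_approx_on {X : Type*} [NormedAddCommGroup X] [NormedSpace ℂ X]
    (W : Submodule ℂ X) [FiniteDimensional ℂ W] (G : Set (X →L[ℂ] ℂ))
    (hG : ∀ ψ ∈ G, ∀ c : ℂ, ‖c‖ = 1 → c • ψ ∈ G) (φ : X →L[ℂ] ℂ)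
    (hφ : ∀ w ∈ W, ∀ u : ℝ, (∀ ψ ∈ G, ‖ψ w‖ ≤ u) → ‖φ w‖ ≤ u) {ε : ℝ} (hε : 0 < ε) :
    ∃ ψ ∈ convexHull ℝ G, ∀ w ∈ W, ‖φ w - ψ w‖ ≤ ε * ‖w‖ := by
  let R : (X →L[ℂ] ℂ) →ₗ[ℝ] StrongDual ℂ W :=
    { toFun := fun ψ => ψ.comp W.subtypeL
      map_add' := fun _ _ => rfl
      map_smul' := fun _ _ => rfl }
  have hmem : R φ ∈ closure (R '' convexHull ℝ G) := by
    by_contra hnot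
    obtain ⟨f, u, hlt, hgt⟩ := RCLike.geometric_hahn_banach_closed_point (𝕜 := ℂ)
      ((convex_convexHull ℝ G).linear_image R).closure isClosed_closure hnot
    obtain ⟨w, hw⟩ := exists_eval_eq_of_finiteDimensional f
    have hbound : ∀ ψ ∈ G, ‖ψ (w : X)‖ ≤ u := by
      intro ψ hψ
      obtain ⟨c, hc, hcw⟩ := Complex.exists_norm_eq_mul_self (ψ (w : X))
      have h := hlt (R (c • ψ))
        (subset_closure ⟨_, subset_convexHull ℝ G (hG ψ hψ c hc), rfl⟩)
      rw [hw] at h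
      have h2 : (R (c • ψ)) w = (‖ψ (w : X)‖ : ℂ) := hcw.symm
      rw [h2] at h
      exact (by simpa using h : ‖ψ (w : X)‖ < u).le
    have h1 := hφ w w.2 u hbound
    rw [hw] at hgt
    have h2 : RCLike.re ((R φ) w) ≤ ‖φ (w : X)‖ := RCLike.re_le_norm _
    linarith
  obtain ⟨_, ⟨ψ, hψ, rfl⟩, hdist⟩ := mem_closure_strongDual_iff.1 hmem ε hε
  refine ⟨ψ, hψ, fun w hw => ?_⟩
  exact ((R φ - R ψ).le_opNorm ⟨w, hw⟩).trans
    (mul_le_mul_of_nonneg_right hdist.le (norm_nonneg w))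

theorem norm_smul_add_smul_sq_le {E : Type*} [SeminormedAddCommGroup E] [NormedSpace ℝ E]
    (x y : E) {a b : ℝ} (ha : 0 ≤ a) (hb : 0 ≤ b) (hab : a + b = 1) :
    ‖a • x + b • y‖ ^ 2 ≤ a * ‖x‖ ^ 2 + b * ‖y‖ ^ 2 :=
  ((convexOn_univ_norm (E := E)).pow (fun _ _ => norm_nonneg _) 2).2
    (Set.mem_univ x) (Set.mem_univ y) ha hb hab

section VectorFunctionals

variable {H : Type*} [NormedAddCommGroup H] [InnerProductSpace ℂ H]

theorem omegaFunctional_apply (ξ η : H) (x : H →L[ℂ] H) : omegaFunctional ξ η x = ⟪η, x ξ⟫_ℂ := rfl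

theorem smul_omegaFunctional (c : ℂ) (ξ η : H) :
    c • omegaFunctional ξ η = omegaFunctional (c • ξ) η := by
  ext x
  simp [omegaFunctional_apply]

theorem norm_omegaFunctional_le (ξ η : H) : ‖omegaFunctional ξ η‖ ≤ ‖ξ‖ * ‖η‖ := by
  refine ContinuousLinearMap.opNorm_le_bound _ (by positivity) fun x => ?_
  rw [omegaFunctional_apply]
  calc ‖⟪η, x ξ⟫_ℂ‖ ≤ ‖η‖ * ‖x ξ‖ := norm_inner_le_norm _ _
    _ ≤ ‖η‖ * (‖x‖ * ‖ξ‖) := by gcongr; exact x.le_opNorm ξ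
    _ = _ := by ring

theorem omegaFunctional_sub_right (ξ η ζ : H) :
    omegaFunctional ξ η - omegaFunctional ξ ζ = omegaFunctional ξ (η - ζ) := by
  ext x
  simp [omegaFunctional_apply]

theorem omegaFunctional_sub_left (ξ η ζ : H) :
    omegaFunctional ξ ζ - omegaFunctional η ζ = omegaFunctional (ξ - η) ζ := by
  ext x
  simp [omegaFunctional_apply]

/-- A convex combination of functionals `ω_{ξ,η}` which nearly attains its norm at `1` is close to
a convex combination of functionals `ω_ξ`. -/
theorem exists_diagonal_of_mem_convexHull {V : Set H} (hunit : ∀ ξ ∈ V, ‖ξ‖ = 1)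
    {ψ : (H →L[ℂ] H) →L[ℂ] ℂ}
    (hψ : ψ ∈ convexHull ℝ
      {φ : (H →L[ℂ] H) →L[ℂ] ℂ | ∃ ξ ∈ V, ∃ η ∈ V, φ = omegaFunctional ξ η}) :
    ∃ ψ' ∈ convexHull ℝ {ψ : (H →L[ℂ] H) →L[ℂ] ℂ | ∃ ξ ∈ V, ψ = omegaFunctional ξ ξ},
      ‖ψ - ψ'‖ ^ 2 + 2 * (ψ 1).re ≤ 2 := by
  refine convexHull_min (t := {ψ | ∃ ψ' ∈ convexHull ℝ
    {ψ : (H →L[ℂ] H) →L[ℂ] ℂ | ∃ ξ ∈ V, ψ = omegaFunctional ξ ξ},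
      ‖ψ - ψ'‖ ^ 2 + 2 * (ψ 1).re ≤ 2}) ?_ ?_ hψ
  · rintro _ ⟨ξ, hξ, η, hη, rfl⟩
    refine ⟨omegaFunctional ξ ξ, subset_convexHull ℝ _ ⟨ξ, hξ, rfl⟩, ?_⟩
    have h1 : ‖omegaFunctional ξ η - omegaFunctional ξ ξ‖ ≤ ‖η - ξ‖ := by
      rw [omegaFunctional_sub_right]
      simpa [hunit ξ hξ] using norm_omegaFunctional_le ξ (η - ξ)
    have h2 : ‖η - ξ‖ ^ 2 = 1 - 2 * (⟪η, ξ⟫_ℂ).re + 1 := by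
      rw [@norm_sub_sq ℂ, hunit ξ hξ, hunit η hη]; simp
    have h3 : omegaFunctional ξ η 1 = ⟪η, ξ⟫_ℂ := rfl
    rw [h3]
    have h4 := pow_le_pow_left₀ (by positivity) h1 2
    linarith
  · rintro ψ₁ ⟨χ₁, hχ₁, h₁⟩ ψ₂ ⟨χ₂, hχ₂, h₂⟩ a b ha hb hab
    refine ⟨a • χ₁ + b • χ₂, convex_convexHull ℝ _ hχ₁ hχ₂ ha hb hab, ?_⟩
    have h := norm_smul_add_smul_sq_le (ψ₁ - χ₁) (ψ₂ - χ₂) ha hb hab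
    have e : a • ψ₁ + b • ψ₂ - (a • χ₁ + b • χ₂) = a • (ψ₁ - χ₁) + b • (ψ₂ - χ₂) := by
      module
    have e2 : ((a • ψ₁ + b • ψ₂) 1).re = a * (ψ₁ 1).re + b * (ψ₂ 1).re := by simp
    rw [e, e2]
    nlinarith [mul_le_mul_of_nonneg_left h₁ ha, mul_le_mul_of_nonneg_left h₂ hb]

variable (U : Submodule ℂ H) [FiniteDimensional ℂ U]

/-- The compression `x ↦ p x p` by the orthogonal projection `p` onto `U`. -/
def compression : (H →L[ℂ] H) →L[ℂ] (H →L[ℂ] H) :=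
  ContinuousLinearMap.mulLeftRight ℂ (H →L[ℂ] H) U.starProjection U.starProjection

theorem compression_apply (x : H →L[ℂ] H) (ξ : H) :
    compression U x ξ = U.starProjection (x (U.starProjection ξ)) := rfl

theorem norm_compression_le : ‖compression U‖ ≤ 1 :=
  (ContinuousLinearMap.opNorm_mulLeftRight_apply_apply_le ℂ (H →L[ℂ] H) _ _).trans
    (mul_le_one₀ U.starProjection_norm_le (norm_nonneg _) U.starProjection_norm_le)

theorem compression_one : compression U 1 = U.starProjection := by
  ext ξ
  rw [compression_apply]
  simp [Submodule.starProjection_eq_self_iff]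

theorem isCompactOperator_compression (x : H →L[ℂ] H) :
    IsCompactOperator (compression U x) := by
  have h : IsCompactOperator U.starProjection := by
    have : ProperSpace U := FiniteDimensional.proper ℂ U
    have hU : IsCompactOperator U.orthogonalProjectionOnto :=
      isCompactOperator_of_locallyCompactSpace_dom U.orthogonalProjectionOnto
    exact hU.clm_comp U.subtypeL
  exact h.comp_clm (x.comp U.starProjection)

theorem finiteDimensional_range_compression :
    FiniteDimensional ℂ (LinearMap.range (compression U).toLinearMap) := by
  let L : (U →L[ℂ] U) →ₗ[ℂ] (H →L[ℂ] H) :=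
    { toFun := fun z => U.subtypeL.comp (z.comp U.orthogonalProjectionOnto)
      map_add' := fun _ _ => by ext; simp
      map_smul' := fun _ _ => by ext; simp }
  have hle : LinearMap.range (compression U).toLinearMap ≤ LinearMap.range L := by
    rintro _ ⟨x, rfl⟩
    exact ⟨U.orthogonalProjectionOnto.comp (x.comp U.subtypeL), rfl⟩
  exact Submodule.finiteDimensional_of_le hle

theorem comp_compression_omegaFunctional (ξ η : H) :
    (omegaFunctional ξ η).comp (compression U) =
      omegaFunctional (U.starProjection ξ) (U.starProjection η) := by
  ext x
  simp only [ContinuousLinearMap.comp_apply, omegaFunctional_apply, compression_apply]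
  rw [Submodule.inner_starProjection_left_eq_right]

theorem norm_sub_comp_compression_sq_le {V : Set H} (hunit : ∀ ξ ∈ V, ‖ξ‖ = 1)
    {ψ : (H →L[ℂ] H) →L[ℂ] ℂ}
    (hψ : ψ ∈ convexHull ℝ {ψ : (H →L[ℂ] H) →L[ℂ] ℂ | ∃ ξ ∈ V, ψ = omegaFunctional ξ ξ}) :
    ‖ψ - ψ.comp (compression U)‖ ^ 2 + 4 * (ψ U.starProjection).re ≤ 4 := by
  refine convexHull_min (t := {ψ : (H →L[ℂ] H) →L[ℂ] ℂ |
    ‖ψ - ψ.comp (compression U)‖ ^ 2 + 4 * (ψ U.starProjection).re ≤ 4}) ?_ ?_ hψ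
  · rintro _ ⟨ξ, hξ, rfl⟩
    rw [Set.mem_ofPred_eq, comp_compression_omegaFunctional]
    set q := U.starProjection ξ with hq
    have hq1 : ‖q‖ ≤ 1 := by
      simpa [hunit ξ hξ] using U.starProjection.le_of_opNorm_le U.starProjection_norm_le ξ
    have h1 : ‖omegaFunctional ξ ξ - omegaFunctional q q‖ ≤ 2 * ‖ξ - q‖ := by
      have e : omegaFunctional ξ ξ - omegaFunctional q q =
          omegaFunctional (ξ - q) ξ + omegaFunctional q (ξ - q) := by
        rw [← omegaFunctional_sub_left, ← omegaFunctional_sub_right]; abel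
      rw [e]
      have a1 := norm_omegaFunctional_le (ξ - q) ξ
      have a2 := norm_omegaFunctional_le q (ξ - q)
      rw [hunit ξ hξ] at a1
      have a3 := mul_le_mul_of_nonneg_right hq1 (norm_nonneg (ξ - q))
      linarith [norm_add_le (omegaFunctional (ξ - q) ξ) (omegaFunctional q (ξ - q))]
    have h2 : (omegaFunctional ξ ξ U.starProjection).re = ‖q‖ ^ 2 := by
      have h := U.re_inner_starProjection_eq_normSq (𝕜 := ℂ) ξ
      rw [omegaFunctional_apply, ← U.inner_starProjection_left_eq_right]
      exact h
    have h3 : ‖ξ - q‖ ^ 2 = 1 - ‖q‖ ^ 2 := by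
      have h4 : (⟪ξ, q⟫_ℂ).re = ‖q‖ ^ 2 := h2
      rw [@norm_sub_sq ℂ, hunit ξ hξ]
      simp only [RCLike.re_to_complex, h4]
      ring
    have h4 := pow_le_pow_left₀ (by positivity) h1 2
    rw [h2]
    nlinarith
  · intro ψ₁ h₁ ψ₂ h₂ a b ha hb hab
    rw [Set.mem_ofPred_eq] at h₁ h₂ ⊢
    have h := norm_smul_add_smul_sq_le (ψ₁ - ψ₁.comp (compression U))
      (ψ₂ - ψ₂.comp (compression U)) ha hb hab
    have e : a • ψ₁ + b • ψ₂ - (a • ψ₁ + b • ψ₂).comp (compression U) =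
        a • (ψ₁ - ψ₁.comp (compression U)) + b • (ψ₂ - ψ₂.comp (compression U)) := by
      ext x
      simp
      ring
    have e2 : ((a • ψ₁ + b • ψ₂) U.starProjection).re =
        a * (ψ₁ U.starProjection).re + b * (ψ₂ U.starProjection).re := by simp
    rw [e, e2]
    nlinarith [mul_le_mul_of_nonneg_left h₁ ha, mul_le_mul_of_nonneg_left h₂ hb]

theorem exists_finiteDimensional_comp_compression_eq {ψ : (H →L[ℂ] H) →L[ℂ] ℂ}
    (hψ : ψ ∈ Submodule.span ℂ
      {φ : (H →L[ℂ] H) →L[ℂ] ℂ | ∃ ξ η : H, φ = omegaFunctional ξ η}) :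
    ∃ U : Submodule ℂ H, ∃ _ : FiniteDimensional ℂ U, ∀ (U' : Submodule ℂ H)
      [FiniteDimensional ℂ U'], U ≤ U' → ψ.comp (compression U') = ψ := by
  induction hψ using Submodule.span_induction with
  | mem ψ h =>
    obtain ⟨ξ, η, rfl⟩ := h
    refine ⟨Submodule.span ℂ {ξ, η}, FiniteDimensional.span_of_finite ℂ (by simp),
      fun U' _ hU => ?_⟩
    rw [comp_compression_omegaFunctional,
      Submodule.starProjection_eq_self_iff.2 (hU (Submodule.subset_span (by simp))),
      Submodule.starProjection_eq_self_iff.2 (hU (Submodule.subset_span (by simp)))]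
  | zero => exact ⟨⊥, inferInstance, fun U' _ _ => by simp⟩
  | add ψ₁ ψ₂ _ _ h₁ h₂ =>
    obtain ⟨U₁, _, h₁⟩ := h₁
    obtain ⟨U₂, _, h₂⟩ := h₂
    refine ⟨U₁ ⊔ U₂, inferInstance, fun U' _ hU => ?_⟩
    rw [ContinuousLinearMap.add_comp, h₁ U' (le_sup_left.trans hU), h₂ U' (le_sup_right.trans hU)]
  | smul c ψ _ h =>
    obtain ⟨U, _, h⟩ := h
    refine ⟨U, inferInstance, fun U' _ hU => ?_⟩
    rw [ContinuousLinearMap.smul_comp, h U' hU]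

/-- A normal functional is approximated in norm by its compressions to finite-dimensional
subspaces. -/
theorem IsNormalFunctional.exists_norm_sub_comp_compression_le {φ : (H →L[ℂ] H) →L[ℂ] ℂ}
    (hφ : IsNormalFunctional φ) {ε : ℝ} (hε : 0 < ε) :
    ∃ U : Submodule ℂ H, ∃ _ : FiniteDimensional ℂ U,
      ‖φ - φ.comp (compression U)‖ ≤ 2 * ε := by
  obtain ⟨ψ, hψ, hdist⟩ := mem_closure_strongDual_iff.1 hφ ε hε
  obtain ⟨U, hU, h⟩ := exists_finiteDimensional_comp_compression_eq hψ
  refine ⟨U, hU, ?_⟩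
  have e : φ - φ.comp (compression U) = (φ - ψ) - (φ - ψ).comp (compression U) := by
    rw [ContinuousLinearMap.sub_comp, h U le_rfl]; abel
  have h1 : ‖(φ - ψ).comp (compression U)‖ ≤ ‖φ - ψ‖ :=
    ((φ - ψ).opNorm_comp_le _).trans
      (mul_le_of_le_one_right (norm_nonneg _) (norm_compression_le U))
  rw [e]
  linarith [norm_sub_le (φ - ψ) ((φ - ψ).comp (compression U))]

theorem isPositive_norm_smul_one_add [CompleteSpace H] {h : H →L[ℂ] H} (hh : IsSelfAdjoint h) :
    ((‖h‖ : ℂ) • (1 : H →L[ℂ] H) + h).IsPositive := by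
  have := ContinuousLinearMap.le_def _ _ |>.1 hh.neg_algebraMap_norm_le_self
  rwa [sub_neg_eq_add, add_comm, Algebra.algebraMap_eq_smul_one, ← Complex.coe_smul] at this

/-- A positive functional of norm one on `B(H)` is unital. -/
theorem IsNormalState.map_one [CompleteSpace H] {φ : (H →L[ℂ] H) →L[ℂ] ℂ}
    (hφ : IsNormalState φ) : φ 1 = 1 := by
  obtain ⟨-, hnorm, hpos⟩ := hφ
  have h1 := hpos 1 ContinuousLinearMap.isPositive_one
  have him : ∀ h : H →L[ℂ] H, IsSelfAdjoint h → (φ h).im = 0 := by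
    intro h hh
    have := (hpos _ (isPositive_norm_smul_one_add hh)).2
    simpa [h1.2] using this
  have hre : ∀ h : H →L[ℂ] H, IsSelfAdjoint h → (φ h).re ≤ ‖h‖ * (φ 1).re := by
    intro h hh
    have := (hpos _ (isPositive_norm_smul_one_add hh.neg)).1
    simpa [h1.2] using this
  have hle : ‖φ‖ ≤ (φ 1).re := by
    refine φ.opNorm_le_bound h1.1 fun x => ?_
    obtain ⟨c, hc, hcx⟩ := Complex.exists_norm_eq_mul_self (φ x)
    have hy := realPart_add_I_smul_imaginaryPart (c • x)
    have e : (φ (c • x)).re = (φ (realPart (c • x) : H →L[ℂ] H)).re := by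
      conv_lhs => rw [← hy]
      rw [φ.map_add, φ.map_smul, Complex.add_re, smul_eq_mul, Complex.I_mul_re,
        him _ (imaginaryPart (c • x)).2, neg_zero, add_zero]
    have e2 : ‖φ x‖ = (φ (c • x)).re := by
      rw [map_smul, smul_eq_mul, ← hcx]; simp
    have e3 : ‖(realPart (c • x) : H →L[ℂ] H)‖ ≤ ‖x‖ :=
      (realPart.norm_le (c • x)).trans (by rw [norm_smul, hc, one_mul])
    rw [e2, e, mul_comm]
    exact (hre _ (realPart (c • x)).2).trans (mul_le_mul_of_nonneg_right e3 h1.1)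
  have hone : ‖φ 1‖ ≤ 1 := by
    have := φ.le_opNorm 1
    rw [hnorm, one_mul] at this
    exact this.trans ContinuousLinearMap.norm_id_le
  have hre1 : (φ 1).re ≤ 1 := (Complex.re_le_norm _).trans hone
  apply Complex.ext
  · simpa using le_antisymm hre1 (hnorm ▸ hle)
  · simpa using h1.2

/-- A normal unital functional that is dominated, on compact perturbations of scalars, by the
support function of the functionals `ω_{ξ,η}` lies in the norm-closed convex hull of the `ω_ξ`. -/
theorem IsNormalFunctional.mem_closure_convexHull {V : Set H} (hunit : ∀ ξ ∈ V, ‖ξ‖ = 1)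
    (hbal : ∀ ξ ∈ V, ∀ c : ℂ, ‖c‖ = 1 → c • ξ ∈ V)
    {φ : (H →L[ℂ] H) →L[ℂ] ℂ} (hφ : IsNormalFunctional φ) (hone : φ 1 = 1)
    (hdom : ∀ (y : H →L[ℂ] H) (c : ℂ), IsCompactOperator y → ∀ u : ℝ,
      (∀ ξ ∈ V, ∀ η ∈ V, ‖omegaFunctional ξ η (y + c • (1 : H →L[ℂ] H))‖ ≤ u) →
        ‖φ (y + c • (1 : H →L[ℂ] H))‖ ≤ u) :
    φ ∈ closure (convexHull ℝ
      {ψ : (H →L[ℂ] H) →L[ℂ] ℂ | ∃ ξ ∈ V, ψ = omegaFunctional ξ ξ}) := by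
  refine mem_closure_strongDual_iff.2 fun δ hδ => ?_
  obtain ⟨t, ht0, ht1, htδ⟩ : ∃ t : ℝ, 0 < t ∧ t ≤ 1 ∧ 3 * t < δ :=
    ⟨min 1 (δ / 4), by positivity, min_le_left _ _, by linarith [min_le_right 1 (δ / 4)]⟩
  obtain ⟨s, hs⟩ : ∃ s : ℝ, s = t ^ 2 / 4 := ⟨_, rfl⟩
  have hs0 : 0 < s := by rw [hs]; positivity
  have hs1 : s ≤ 1 := by rw [hs]; nlinarith
  obtain ⟨ε, hεs⟩ : ∃ ε : ℝ, ε = s ^ 2 / 2 := ⟨_, rfl⟩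
  have hε : 0 < ε := by rw [hεs]; positivity
  obtain ⟨U, _, hU⟩ := hφ.exists_norm_sub_comp_compression_le hε
  have := finiteDimensional_range_compression U
  let W : Submodule ℂ (H →L[ℂ] H) :=
    LinearMap.range (compression U).toLinearMap ⊔ Submodule.span ℂ {1}
  obtain ⟨ψ, hψ, happrox⟩ := exists_mem_convexHull_approx_on W
    {φ : (H →L[ℂ] H) →L[ℂ] ℂ | ∃ ξ ∈ V, ∃ η ∈ V, φ = omegaFunctional ξ η}
    (by
      rintro _ ⟨ξ, hξ, η, hη, rfl⟩ c hc
      exact ⟨c • ξ, hbal ξ hξ c hc, η, hη, smul_omegaFunctional c ξ η⟩) φ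
    (by
      intro w hw u hu
      obtain ⟨_, ⟨x, rfl⟩, _, hz, rfl⟩ := Submodule.mem_sup.1 hw
      obtain ⟨c, rfl⟩ := Submodule.mem_span_singleton.1 hz
      exact hdom _ c (isCompactOperator_compression U x) u
        fun ξ hξ η hη => hu _ ⟨ξ, hξ, η, hη, rfl⟩) hε
  obtain ⟨χ, hχ, hψχ⟩ := exists_diagonal_of_mem_convexHull hunit hψ
  have hψ1 : 1 - (ψ 1).re ≤ ε := by
    have h := happrox 1 (Submodule.mem_sup_right (Submodule.mem_span_singleton_self 1))
    have h2 : ‖(1 : H →L[ℂ] H)‖ ≤ 1 := ContinuousLinearMap.norm_id_le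
    have h3 := Complex.re_le_norm (φ 1 - ψ 1)
    rw [hone] at h h3
    simp only [Complex.sub_re, Complex.one_re] at h3
    nlinarith
  have hψχs : ‖ψ - χ‖ ≤ s := by
    refine abs_le_of_sq_le_sq' ?_ hs0.le |>.2
    linarith
  have hcomp : ‖φ.comp (compression U) - χ.comp (compression U)‖ ≤ ε + s := by
    have h1 : ‖φ.comp (compression U) - ψ.comp (compression U)‖ ≤ ε := by
      refine ContinuousLinearMap.opNorm_le_bound _ hε.le fun x => ?_
      refine (happrox (compression U x) (Submodule.mem_sup_left ⟨x, rfl⟩)).trans ?_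
      gcongr
      simpa using (compression U).le_of_opNorm_le (norm_compression_le U) x
    have h2 : ‖(ψ - χ).comp (compression U)‖ ≤ s :=
      (((ψ - χ).opNorm_comp_le _).trans
        (mul_le_of_le_one_right (norm_nonneg _) (norm_compression_le U))).trans hψχs
    rw [ContinuousLinearMap.sub_comp] at h2
    exact (norm_sub_le_norm_sub_add_norm_sub _ (ψ.comp (compression U)) _).trans (add_le_add h1 h2)
  have hχp : 1 - (χ U.starProjection).re ≤ 3 * ε + s := by
    have h2 : ‖(1 : H →L[ℂ] H)‖ ≤ 1 := ContinuousLinearMap.norm_id_le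
    have h3 : ‖(φ - χ.comp (compression U)) 1‖ ≤ (2 * ε + (ε + s)) * 1 :=
      ContinuousLinearMap.le_of_opNorm_le_of_le _
        ((norm_sub_le_norm_sub_add_norm_sub _ _ _).trans (add_le_add hU hcomp)) h2
    have h4 := Complex.re_le_norm ((φ - χ.comp (compression U)) 1)
    rw [sub_apply, ContinuousLinearMap.comp_apply, compression_one,
      hone] at h3 h4
    simp only [Complex.sub_re, Complex.one_re] at h4
    linarith
  have hχU : ‖χ - χ.comp (compression U)‖ ≤ 2 * t := by
    have h := norm_sub_comp_compression_sq_le U hunit hχ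
    refine abs_le_of_sq_le_sq' ?_ (by positivity) |>.2
    nlinarith
  refine ⟨χ, hχ, ?_⟩
  have e : φ - χ = (φ - φ.comp (compression U)) +
      (φ.comp (compression U) - χ.comp (compression U)) - (χ - χ.comp (compression U)) := by abel
  rw [e]
  have h1 := norm_sub_le ((φ - φ.comp (compression U)) +
      (φ.comp (compression U) - χ.comp (compression U))) (χ - χ.comp (compression U))
  have h2 := norm_add_le (φ - φ.comp (compression U))
      (φ.comp (compression U) - χ.comp (compression U))
  nlinarith

end VectorFunctionals

/-- With `V`, `K` as above, let `A := K(H) + ℂ·1` be the unitization of the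
compact operators and `E(ψ) := sup {|ψ(x)| : x ∈ A, ‖x‖_K ≤ 1}`. Then for every normal state
`φ` on `B(H)` the following are equivalent: (i) `φ` lies in the norm-closed convex hull of
`{ω_ξ : ξ ∈ V}`; (ii) `E(φ) = 1`; (iii) `q_K(φ) = 1`. -/
theorem stmt3 {H : Type*} [NormedAddCommGroup H] [InnerProductSpace ℂ H] [CompleteSpace H]
    (V : Set H)
    (hunit : ∀ ξ ∈ V, ‖ξ‖ = 1)
    (hbal : ∀ ξ ∈ V, ∀ c : ℂ, ‖c‖ = 1 → c • ξ ∈ V)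
    (hsep : ∀ ξ : H, (∀ η ∈ V, ⟪ξ, η⟫_ℂ = 0) → ξ = 0)
    (K : Set ((H →L[ℂ] H) →L[ℂ] ℂ))
    (hK : K = closure (convexHull ℝ
      {φ : (H →L[ℂ] H) →L[ℂ] ℂ | ∃ ξ ∈ V, ∃ η ∈ V, φ = omegaFunctional ξ η}))
    (A : Set (H →L[ℂ] H))
    (hA : A = {x : H →L[ℂ] H | ∃ (y : H →L[ℂ] H) (c : ℂ),
      IsCompactOperator (⇑y) ∧ x = y + c • (1 : H →L[ℂ] H)})
    (E : ((H →L[ℂ] H) →L[ℂ] ℂ) → ℝ≥0∞)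
    (hE : ∀ ψ, E ψ = ⨆ x ∈ {x : H →L[ℂ] H | x ∈ A ∧ normK K x ≤ 1}, ENNReal.ofReal ‖ψ x‖)
    (φ : (H →L[ℂ] H) →L[ℂ] ℂ) (hφ : IsNormalState φ) :
    (φ ∈ closure (convexHull ℝ
        {ψ : (H →L[ℂ] H) →L[ℂ] ℂ | ∃ ξ ∈ V, ψ = omegaFunctional ξ ξ}) ↔ E φ = 1) ∧
    (E φ = 1 ↔ qK K φ = 1) := by
  subst hK hA
  set G : Set ((H →L[ℂ] H) →L[ℂ] ℂ) := {φ | ∃ ξ ∈ V, ∃ η ∈ V, φ = omegaFunctional ξ η}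
  set S : Set ((H →L[ℂ] H) →L[ℂ] ℂ) := {ψ | ∃ ξ ∈ V, ψ = omegaFunctional ξ ξ}
  have hone : φ 1 = 1 := hφ.map_one
  have hSG : S ⊆ G := by
    rintro _ ⟨ξ, hξ, rfl⟩
    exact ⟨ξ, hξ, ξ, hξ, rfl⟩
  have hKball : ∀ ψ ∈ closure (convexHull ℝ G), ‖ψ‖ ≤ 1 := by
    have : closure (convexHull ℝ G) ⊆ Metric.closedBall 0 1 := by
      refine closure_minimal (convexHull_min ?_ (convex_closedBall 0 1)) Metric.isClosed_closedBall
      rintro _ ⟨ξ, hξ, η, hη, rfl⟩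
      simpa [hunit ξ hξ, hunit η hη] using norm_omegaFunctional_le ξ η
    exact fun ψ hψ => by simpa using this hψ
  have hle_normK : ∀ ψ ∈ closure (convexHull ℝ G), ∀ x,
      ‖ψ x‖ ≤ normK (closure (convexHull ℝ G)) x := by
    intro ψ hψ x
    refine le_csSup ⟨‖x‖, ?_⟩ ⟨ψ, hψ, rfl⟩
    rintro _ ⟨χ, hχ, rfl⟩
    simpa using χ.le_of_opNorm_le (hKball χ hχ) x
  have hnorm_one : ‖(1 : H →L[ℂ] H)‖ ≤ 1 := ContinuousLinearMap.norm_id_le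
  have hnormK_le : ∀ x u, 0 ≤ u → (∀ ψ ∈ G, ‖ψ x‖ ≤ u) →
      normK (closure (convexHull ℝ G)) x ≤ u := by
    intro x u hu h
    refine Real.sSup_le ?_ hu
    rintro _ ⟨ψ, hψ, rfl⟩
    have hsub : closure (convexHull ℝ G) ⊆ {ψ | ‖ψ x‖ ≤ u} := by
      refine closure_minimal (convexHull_min h ?_) (isClosed_le (by fun_prop) continuous_const)
      intro ψ₁ h₁ ψ₂ h₂ a b ha hb hab
      have := convex_closedBall (0 : ℂ) u (x := ψ₁ x) (by simpa using h₁)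
        (y := ψ₂ x) (by simpa using h₂) ha hb hab
      simpa using this
    exact hsub hψ
  have hE1 : 1 ≤ E φ := by
    rw [hE]
    refine le_trans ?_ (le_iSup₂_of_le (1 : H →L[ℂ] H)
      ⟨⟨0, 1, isCompactOperator_zero, by simp⟩, ?_⟩ le_rfl)
    · simp [hone]
    · refine hnormK_le 1 1 zero_le_one fun ψ hψ => ?_
      have := ψ.le_of_opNorm_le_of_le
        (hKball ψ (subset_closure (subset_convexHull ℝ G hψ))) hnorm_one
      simpa using this
  have hi_iii : φ ∈ closure (convexHull ℝ S) → qK (closure (convexHull ℝ G)) φ = 1 := by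
    intro h
    have hmem : φ ∈ closure (convexHull ℝ G) := closure_mono (convexHull_mono hSG) h
    refine le_antisymm (sInf_le ⟨1, zero_le_one, by simp, by simpa using hmem⟩) (le_sInf ?_)
    rintro _ ⟨r, hr, rfl, ψ, hψ, hψφ⟩
    have hr1 : 1 ≤ r := by
      rw [← hφ.2.1, ← hψφ]
      change ‖r • ψ‖ ≤ r
      rw [norm_smul, Real.norm_of_nonneg hr]
      exact mul_le_of_le_one_right hr (hKball ψ hψ)
    simpa using hr1
  have hiii_ii : qK (closure (convexHull ℝ G)) φ = 1 → E φ = 1 := by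
    intro h
    refine le_antisymm ?_ hE1
    rw [← h, hE]
    refine iSup₂_le fun x hx => le_sInf ?_
    rintro _ ⟨r, hr, rfl, ψ, hψ, rfl⟩
    refine ENNReal.ofReal_le_ofReal ?_
    change ‖r • ψ x‖ ≤ r
    rw [norm_smul, Real.norm_of_nonneg hr]
    exact mul_le_of_le_one_right hr ((hle_normK ψ hψ x).trans hx.2)
  have hii_i : E φ = 1 → φ ∈ closure (convexHull ℝ S) := by
    intro h
    refine hφ.1.mem_closure_convexHull hunit hbal hone fun y c hy u hu => ?_
    have hV : V.Nonempty := by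
      by_contra hV
      have hzero : ∀ v : H, v = 0 := fun v =>
        hsep v fun η hη => (hV ⟨η, hη⟩).elim
      have h10 : (1 : H →L[ℂ] H) = 0 := by
        ext v
        rw [hzero v]; simp
      rw [h10, map_zero] at hone
      exact zero_ne_one hone
    obtain ⟨ξ₀, hξ₀⟩ := hV
    have hu0 : 0 ≤ u := (norm_nonneg _).trans (hu ξ₀ hξ₀ ξ₀ hξ₀)
    refine le_of_forall_gt_imp_ge_of_dense fun v hv => ?_
    have hv0 : 0 < v := hu0.trans_lt hv
    have key : ENNReal.ofReal ‖φ (((v⁻¹ : ℝ) : ℂ) • (y + c • (1 : H →L[ℂ] H)))‖ ≤ 1 := by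
      rw [← h, hE]
      refine le_iSup₂_of_le (((v⁻¹ : ℝ) : ℂ) • (y + c • (1 : H →L[ℂ] H)))
        ⟨⟨((v⁻¹ : ℝ) : ℂ) • y, ((v⁻¹ : ℝ) : ℂ) * c, hy.smul _, by
          rw [smul_add, smul_smul]⟩, ?_⟩ le_rfl
      refine hnormK_le _ 1 zero_le_one ?_
      rintro _ ⟨ξ, hξ, η, hη, rfl⟩
      rw [map_smul, norm_smul, Complex.norm_real, Real.norm_of_nonneg (inv_nonneg.2 hv0.le),
        inv_mul_le_one₀ hv0]
      exact (hu ξ hξ η hη).trans hv.le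
    rw [map_smul, norm_smul, Complex.norm_real, Real.norm_of_nonneg (inv_nonneg.2 hv0.le),
      ENNReal.ofReal_le_one, inv_mul_le_one₀ hv0] at key
    exact key
  exact ⟨⟨fun h => hiii_ii (hi_iii h), hii_i⟩, fun h => hi_iii (hii_i h), hiii_ii⟩
end
end

section
/- Let H be an infinite dimensional complex Hilbert space and l ∈ ℕ with l ≥ 2. Then sup{r ≥ 1 : r·P₋V^{⊗2}_l ⊂ B₁(H^{⊗2})} = 1, and V^{∧2}_l = (√2·P₋V^{⊗2}_l) ∩ S₁(H^{⊗2}); i.e. the unit vectors of H∧H of Slater rank ≤ l are exactly the unit-norm vectors of the form √2·P₋ξ with ξ a unit vector of H⊗H of Schmidt rank ≤ l. -/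
noncomputable section

open scoped InnerProductSpace ENNReal Pointwise

/-- An abstract presentation of the `k`-fold Hilbert space tensor power `H^{⊗k}` of `H`,
realized on a Hilbert space `T`: a continuous multilinear map `tprod` (the elementary tensors
`η₁ ⊗ ... ⊗ η_k`) whose inner products multiply, whose range has dense linear span, together
with the permutation unitaries `U_π` permuting the tensor factors. -/
structure HilbertTensorPower (k : ℕ) (H T : Type*) [NormedAddCommGroup H]
    [InnerProductSpace ℂ H] [NormedAddCommGroup T] [InnerProductSpace ℂ T] where
  tprod : ContinuousMultilinearMap ℂ (fun _ : Fin k => H) T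
  inner_tprod : ∀ ξ η : Fin k → H, ⟪tprod ξ, tprod η⟫_ℂ = ∏ i, ⟪ξ i, η i⟫_ℂ
  span_dense : (Submodule.span ℂ (Set.range ⇑tprod)).topologicalClosure = ⊤
  U : Equiv.Perm (Fin k) → (T →L[ℂ] T)
  U_isometry : ∀ π, Isometry ⇑(U π)
  U_surjective : ∀ π, Function.Surjective ⇑(U π)
  U_tprod : ∀ (π : Equiv.Perm (Fin k)) (ξ : Fin k → H),
    U π (tprod ξ) = tprod fun i => ξ (π i)

namespace HilbertTensorPower

variable {k : ℕ} {H T : Type*} [NormedAddCommGroup H] [InnerProductSpace ℂ H]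
  [NormedAddCommGroup T] [InnerProductSpace ℂ T]

/-- The symmetrization projection `P₊ = (1/k!) Σ_π U_π`. -/
def Pplus (P : HilbertTensorPower k H T) : T →L[ℂ] T :=
  ((k.factorial : ℂ))⁻¹ • ∑ π : Equiv.Perm (Fin k), P.U π

/-- The antisymmetrization projection `P₋ = (1/k!) Σ_π sign(π) U_π`. -/
def Pminus (P : HilbertTensorPower k H T) : T →L[ℂ] T :=
  ((k.factorial : ℂ))⁻¹ •
    ∑ π : Equiv.Perm (Fin k), (((Equiv.Perm.sign π : ℤ) : ℂ)) • P.U π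

/-- The wedge product `η₁ ∧ ... ∧ η_k := √(k!) · P₋(η₁ ⊗ ... ⊗ η_k)`. -/
def wedge (P : HilbertTensorPower k H T) (η : Fin k → H) : T :=
  (Real.sqrt k.factorial : ℂ) • P.Pminus (P.tprod η)

/-- The set `V^{⊗k}` of unit product vectors. -/
def prodVecs (P : HilbertTensorPower k H T) : Set T :=
  {ζ : T | ∃ η : Fin k → H, (∀ i, ‖η i‖ = 1) ∧ ζ = P.tprod η}

/-- The set `V^{∨k}` of symmetric unit product vectors `η ⊗ ... ⊗ η`. -/
def symVecs (P : HilbertTensorPower k H T) : Set T :=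
  {ζ : T | ∃ η : H, ‖η‖ = 1 ∧ ζ = P.tprod fun _ => η}

/-- The set `V^{∧k}` of unit wedge (Slater) vectors. -/
def wedgeVecs (P : HilbertTensorPower k H T) : Set T :=
  {ζ : T | ∃ η : Fin k → H, ζ = P.wedge η ∧ ‖ζ‖ = 1}

end HilbertTensorPower

namespace HilbertTensorPower

theorem update_vec_zero {α : Type*} (u v a : α) : Function.update ![u, v] 0 a = ![a, v] := by
  ext i
  fin_cases i <;> simp

theorem update_vec_one {α : Type*} (u v a : α) : Function.update ![u, v] 1 a = ![u, a] := by
  ext i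
  fin_cases i <;> simp

section Pair

variable {H T : Type*} [NormedAddCommGroup H] [InnerProductSpace ℂ H]
  [NormedAddCommGroup T] [InnerProductSpace ℂ T]

/-- The elementary tensor `u ⊗ v` in a Hilbert tensor square, as a bilinear map. -/
def pair (Q : HilbertTensorPower 2 H T) : H →ₗ[ℂ] H →ₗ[ℂ] T :=
  LinearMap.mk₂ ℂ (fun u v => Q.tprod ![u, v])
    (fun u u' v => by
      have h := Q.tprod.map_update_add ![u, v] 0 u u'
      simpa only [update_vec_zero] using h)
    (fun c u v => by
      have h := Q.tprod.map_update_smul ![u, v] 0 c u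
      simpa only [update_vec_zero] using h)
    (fun u v v' => by
      have h := Q.tprod.map_update_add ![u, v] 1 v v'
      simpa only [update_vec_one] using h)
    (fun c u v => by
      have h := Q.tprod.map_update_smul ![u, v] 1 c v
      simpa only [update_vec_one] using h)

theorem tprod_eq_pair (Q : HilbertTensorPower 2 H T) (η : Fin 2 → H) :
    Q.tprod η = Q.pair (η 0) (η 1) := by
  rw [pair, LinearMap.mk₂_apply]
  congr 1
  ext i
  fin_cases i <;> rfl

theorem inner_pair (Q : HilbertTensorPower 2 H T) (u v u' v' : H) :
    ⟪Q.pair u v, Q.pair u' v'⟫_ℂ = ⟪u, u'⟫_ℂ * ⟪v, v'⟫_ℂ := by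
  simp [pair, Q.inner_tprod]

theorem norm_pair (Q : HilbertTensorPower 2 H T) (u v : H) :
    ‖Q.pair u v‖ = ‖u‖ * ‖v‖ := by
  have h := Q.inner_pair u v u v
  simp only [inner_self_eq_norm_sq_to_K] at h
  have h' : ‖Q.pair u v‖ ^ 2 = (‖u‖ * ‖v‖) ^ 2 := by
    rw [mul_pow]
    exact_mod_cast h
  exact (pow_left_inj₀ (norm_nonneg _) (by positivity) two_ne_zero).1 h'

theorem norm_U (Q : HilbertTensorPower 2 H T) (π : Equiv.Perm (Fin 2)) (x : T) :
    ‖Q.U π x‖ = ‖x‖ :=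
  (AddMonoidHomClass.isometry_iff_norm (Q.U π)).1 (Q.U_isometry π) x

theorem U_swap_pair (Q : HilbertTensorPower 2 H T) (u v : H) :
    Q.U (Equiv.swap 0 1) (Q.pair u v) = Q.pair v u := by
  rw [show Q.pair u v = Q.tprod ![u, v] from rfl, Q.U_tprod, tprod_eq_pair]
  simp

theorem U_one_pair (Q : HilbertTensorPower 2 H T) (u v : H) :
    Q.U 1 (Q.pair u v) = Q.pair u v := by
  rw [show Q.pair u v = Q.tprod ![u, v] from rfl, Q.U_tprod]
  rfl

theorem Pminus_two_apply (Q : HilbertTensorPower 2 H T) (x : T) :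
    Q.Pminus x = (2 : ℂ)⁻¹ • (Q.U 1 x - Q.U (Equiv.swap 0 1) x) := by
  have huniv : (Finset.univ : Finset (Equiv.Perm (Fin 2))) = {1, Equiv.swap 0 1} := by decide
  have hne : (1 : Equiv.Perm (Fin 2)) ≠ Equiv.swap 0 1 := by decide
  simp [Pminus, huniv, Finset.sum_pair hne, sub_eq_add_neg]

theorem Pminus_pair (Q : HilbertTensorPower 2 H T) (u v : H) :
    Q.Pminus (Q.pair u v) = (2 : ℂ)⁻¹ • (Q.pair u v - Q.pair v u) := by
  rw [Pminus_two_apply, U_swap_pair, U_one_pair]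

theorem norm_Pminus_le (Q : HilbertTensorPower 2 H T) (x : T) : ‖Q.Pminus x‖ ≤ ‖x‖ := by
  rw [Pminus_two_apply, norm_smul]
  have h := norm_sub_le (Q.U 1 x) (Q.U (Equiv.swap 0 1) x)
  rw [norm_U, norm_U] at h
  norm_num
  linarith

theorem wedge_two (Q : HilbertTensorPower 2 H T) (η : Fin 2 → H) :
    Q.wedge η = (Real.sqrt 2 : ℂ) • Q.Pminus (Q.pair (η 0) (η 1)) := by
  simp [wedge, tprod_eq_pair]

theorem exists_smul_unit [Nontrivial H] (u : H) : ∃ (c : ℂ) (e : H), ‖e‖ = 1 ∧ u = c • e := by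
  by_cases hu : u = 0
  · obtain ⟨e, he⟩ := exists_norm_eq H zero_le_one
    exact ⟨0, e, he, by simp [hu]⟩
  · have hn : (‖u‖ : ℂ) ≠ 0 := by simpa using hu
    refine ⟨‖u‖, (‖u‖ : ℂ)⁻¹ • u, ?_, ?_⟩
    · rw [norm_smul]
      simp [hu]
    · rw [smul_inv_smul₀ hn]

/-- A sum of `l` elementary tensors is a combination of `l` unit product vectors. -/
theorem exists_sum_pair_eq_sum_smul_tprod [Nontrivial H] (Q : HilbertTensorPower 2 H T) {l : ℕ}
    (u v : Fin l → H) :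
    ∃ (c : Fin l → ℂ) (η : Fin l → Fin 2 → H),
      (∀ i j, ‖η i j‖ = 1) ∧ ∑ i, Q.pair (u i) (v i) = ∑ i, c i • Q.tprod (η i) := by
  choose a e he hu using fun i => exists_smul_unit (u i)
  choose b f hf hv using fun i => exists_smul_unit (v i)
  refine ⟨fun i => a i * b i, fun i => ![e i, f i], ?_, ?_⟩
  · intro i j
    fin_cases j
    · exact he i
    · exact hf i
  · refine Finset.sum_congr rfl fun i _ => ?_
    rw [hu i, hv i, tprod_eq_pair]
    simp only [map_smul, LinearMap.smul_apply, smul_smul, Matrix.cons_val_zero,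
      Matrix.cons_val_one, mul_comm (b i)]

theorem exists_orthonormal_pair (hinf : ¬ FiniteDimensional ℂ H) :
    ∃ e f : H, ‖e‖ = 1 ∧ ‖f‖ = 1 ∧ ⟪e, f⟫_ℂ = 0 := by
  have hnt : Nontrivial H := by
    by_contra h
    rw [not_nontrivial_iff_subsingleton] at h
    exact hinf inferInstance
  obtain ⟨e, he⟩ := exists_norm_eq H zero_le_one
  have hS : (ℂ ∙ e)ᗮ ≠ ⊥ := by
    intro h
    rw [Submodule.orthogonal_eq_bot_iff] at h
    exact hinf (Module.finite_def.2 (h ▸ Submodule.fg_span_singleton e))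
  obtain ⟨g, hg, hg0⟩ := Submodule.exists_mem_ne_zero_of_ne_bot hS
  rw [Submodule.mem_orthogonal_singleton_iff_inner_right] at hg
  refine ⟨e, (‖g‖ : ℂ)⁻¹ • g, he, ?_, ?_⟩
  · rw [norm_smul]
    simp [hg0]
  · rw [inner_smul_right, hg, mul_zero]

theorem norm_wedge_of_orthonormal (Q : HilbertTensorPower 2 H T) {e f : H} (he : ‖e‖ = 1)
    (hf : ‖f‖ = 1) (hef : ⟪e, f⟫_ℂ = 0) : ‖Q.wedge ![e, f]‖ = 1 := by
  have hfe : ⟪f, e⟫_ℂ = 0 := inner_eq_zero_symm.1 hef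
  have h0 : ⟪Q.pair e f, Q.pair f e⟫_ℂ = 0 := by rw [inner_pair, hef, zero_mul]
  have h1 := @norm_sub_sq ℂ T _ _ _ (Q.pair e f) (Q.pair f e)
  rw [h0, norm_pair, norm_pair, he, hf] at h1
  norm_num at h1
  have h2 : ‖Q.pair e f - Q.pair f e‖ = Real.sqrt 2 := by
    rw [← h1, Real.sqrt_sq (norm_nonneg _)]
  rw [wedge_two, Pminus_pair, norm_smul, norm_smul]
  simp only [Matrix.cons_val_zero, Matrix.cons_val_one]
  rw [h2, Complex.norm_real, Real.norm_of_nonneg (Real.sqrt_nonneg 2)]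
  have h3 := Real.mul_self_sqrt (zero_le_two (α := ℝ))
  norm_num
  linarith

/-- Every wedge is a multiple of a unit wedge, provided some unit wedge exists. -/
theorem exists_wedge_eq_smul (Q : HilbertTensorPower 2 H T) {ω : Fin 2 → H}
    (hω : ‖Q.wedge ω‖ = 1) (u v : H) :
    ∃ (a : ℂ) (θ : Fin 2 → H), ‖Q.wedge θ‖ = 1 ∧ Q.wedge ![u, v] = a • Q.wedge θ := by
  by_cases h : Q.wedge ![u, v] = 0
  · exact ⟨0, ω, hω, by simp [h]⟩
  · have hn : (‖Q.wedge ![u, v]‖ : ℂ) ≠ 0 := by simpa using h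
    have hs : Q.wedge ![(‖Q.wedge ![u, v]‖ : ℂ)⁻¹ • u, v] =
        (‖Q.wedge ![u, v]‖ : ℂ)⁻¹ • Q.wedge ![u, v] := by
      simp only [wedge_two, Matrix.cons_val_zero, Matrix.cons_val_one, map_smul,
        LinearMap.smul_apply]
      rw [smul_comm]
    refine ⟨‖Q.wedge ![u, v]‖, ![(‖Q.wedge ![u, v]‖ : ℂ)⁻¹ • u, v], ?_, ?_⟩
    · rw [hs, norm_smul]
      simp [h]
    · rw [hs, smul_inv_smul₀ hn]

/-- An antisymmetrized sum of elementary tensors `u i ⊗ v i` lifts to a sum of elementary tensors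
with the same left factors whose norm is at most that of the wedge. -/
theorem exists_lift_norm_le (Q : HilbertTensorPower 2 H T) {l : ℕ} (u v : Fin l → H) :
    ∃ w : Fin l → H,
      Q.Pminus (∑ i, Q.pair (u i) (w i)) = Q.Pminus (∑ i, Q.pair (u i) (v i)) ∧
      ‖∑ i, Q.pair (u i) (w i)‖ ≤
        ‖(Real.sqrt 2 : ℂ) • Q.Pminus (∑ i, Q.pair (u i) (v i))‖ := by
  set S := Submodule.span ℂ (Set.range u)
  have : FiniteDimensional ℂ S := FiniteDimensional.span_of_finite ℂ (Set.finite_range u)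
  have hu : ∀ i, u i ∈ S := fun i => Submodule.subset_span ⟨i, rfl⟩
  set a : Fin l → H := fun i => S.starProjection (v i)
  set b : Fin l → H := fun i => v i - a i with hbdef
  have ha : ∀ i, a i ∈ S := fun i => S.starProjection_apply_mem (v i)
  have hb : ∀ i, b i ∈ Sᗮ := fun i => S.sub_starProjection_mem_orthogonal (v i)
  have hSb : ∀ s ∈ S, ∀ i, ⟪s, b i⟫_ℂ = 0 := fun s hs i =>
    Submodule.inner_right_of_mem_orthogonal hs (hb i)
  have hbS : ∀ s ∈ S, ∀ i, ⟪b i, s⟫_ℂ = 0 := fun s hs i =>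
    Submodule.inner_left_of_mem_orthogonal hs (hb i)
  choose m hm using fun i => (Submodule.mem_span_range_iff_exists_fun ℂ).1 (ha i)
  set x := ∑ i, Q.pair (u i) (b i) with hx
  set x' := ∑ i, Q.pair (b i) (u i) with hx'
  set y := ∑ i, (2 : ℂ)⁻¹ • (Q.pair (u i) (a i) - Q.pair (a i) (u i)) with hy
  have hxx' : Q.U (Equiv.swap 0 1) x = x' := by
    simp [hx, hx', U_swap_pair]
  have hnx : ‖x'‖ = ‖x‖ := by rw [← hxx', norm_U]
  have hPx : Q.Pminus x = (2 : ℂ)⁻¹ • (x - x') := by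
    simp [hx, hx', Pminus_pair, Finset.smul_sum, smul_sub]
  have hPy : Q.Pminus y = y := by
    simp only [hy, map_sum, map_smul, map_sub, Pminus_pair]
    refine Finset.sum_congr rfl fun i _ => ?_
    module
  have hv : Q.Pminus (∑ i, Q.pair (u i) (v i)) = (2 : ℂ)⁻¹ • (x - x') + y := by
    rw [← hPx, hx, hy]
    simp only [map_sum, ← Finset.sum_add_distrib]
    refine Finset.sum_congr rfl fun i _ => ?_
    rw [← Pminus_pair, ← map_add, ← map_add]
    simp [hbdef]
  have hsum : ∑ i, Q.pair (u i) (b i + (2 : ℂ)⁻¹ • a i - ∑ j, (2 : ℂ)⁻¹ • m j i • u j) =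
      x + y := by
    have hau : ∑ i, Q.pair (a i) (u i) = ∑ i, ∑ j, m j i • Q.pair (u i) (u j) := by
      rw [Finset.sum_comm]
      refine Finset.sum_congr rfl fun j _ => ?_
      conv_lhs => rw [← hm j]
      simp
    simp only [map_add, map_sub, map_smul, map_sum, Finset.sum_add_distrib, Finset.sum_sub_distrib,
      hx, hy, smul_sub, ← Finset.smul_sum]
    rw [hau]
    abel
  have h1 : ⟪x, x'⟫_ℂ = 0 := by
    simp only [hx, hx', sum_inner, inner_sum, inner_pair]
    exact Finset.sum_eq_zero fun i _ => Finset.sum_eq_zero fun j _ => by simp [hSb _ (hu _)]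
  have h2 : ⟪x, y⟫_ℂ = 0 := by
    simp only [hx, hy, sum_inner, inner_sum, inner_smul_right, inner_sub_right, inner_pair]
    simp [hbS _ (hu _), hbS _ (ha _)]
  have h3 : ⟪x', y⟫_ℂ = 0 := by
    simp only [hx', hy, sum_inner, inner_sum, inner_smul_right, inner_sub_right, inner_pair]
    simp [hbS _ (hu _), hbS _ (ha _)]
  refine ⟨fun i => b i + (2 : ℂ)⁻¹ • a i - ∑ j, (2 : ℂ)⁻¹ • m j i • u j, ?_, ?_⟩
  · rw [hsum, map_add, hPx, hPy, hv]
  · rw [hsum, hv, norm_smul, Complex.norm_real, Real.norm_of_nonneg (Real.sqrt_nonneg 2)]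
    refine le_of_sq_le_sq ?_ (by positivity)
    have e1 := @norm_add_sq ℂ T _ _ _ x y
    have e2 := @norm_sub_sq ℂ T _ _ _ x x'
    have e3 := @norm_add_sq ℂ T _ _ _ ((2 : ℂ)⁻¹ • (x - x')) y
    have e4 : ⟪(2 : ℂ)⁻¹ • (x - x'), y⟫_ℂ = 0 := by
      rw [inner_smul_left, inner_sub_left, h2, h3, sub_zero, mul_zero]
    have e5 : ‖(2 : ℂ)⁻¹ • (x - x')‖ = 2⁻¹ * ‖x - x'‖ := by
      rw [norm_smul]
      norm_num
    rw [h2] at e1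
    rw [h1, hnx] at e2
    rw [e4, e5, mul_pow, e2] at e3
    simp only [map_zero, mul_zero, add_zero, sub_zero] at e1 e3
    rw [mul_pow, Real.sq_sqrt zero_le_two, e1, e3]
    nlinarith [sq_nonneg ‖y‖]

/-- Adding a symmetric product vector to one summand, the norm of a sum of elementary tensors can be
increased to any prescribed value without changing its antisymmetrization. -/
theorem exists_lift_norm_eq (Q : HilbertTensorPower 2 H T) {l : ℕ} (u w : Fin l → H) {R : ℝ}
    (hR : ‖∑ i, Q.pair (u i) (w i)‖ ≤ R) {k : Fin l} (hk : u k ≠ 0) :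
    ∃ z : Fin l → H,
      Q.Pminus (∑ i, Q.pair (u i) (z i)) = Q.Pminus (∑ i, Q.pair (u i) (w i)) ∧
      ‖∑ i, Q.pair (u i) (z i)‖ = R := by
  set x := ∑ i, Q.pair (u i) (w i) with hx
  set d := Q.pair (u k) (u k) with hd
  have hdpos : 0 < ‖d‖ := by
    rw [hd, norm_pair]
    have := norm_pos_iff.2 hk
    positivity
  have hRnn : 0 ≤ R := (norm_nonneg _).trans hR
  have hcont : Continuous fun t : ℝ => ‖x + (t : ℂ) • d‖ := by fun_prop
  have hM : 0 ≤ (R + ‖x‖) / ‖d‖ := by positivity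
  have hlarge : R ≤ ‖x + (((R + ‖x‖) / ‖d‖ : ℝ) : ℂ) • d‖ := by
    have h := norm_sub_le (x + (((R + ‖x‖) / ‖d‖ : ℝ) : ℂ) • d) x
    rw [add_sub_cancel_left, norm_smul, Complex.norm_real, Real.norm_of_nonneg hM,
      div_mul_cancel₀ _ hdpos.ne'] at h
    linarith
  obtain ⟨t, -, ht⟩ := intermediate_value_Icc hM hcont.continuousOn
    (show R ∈ Set.Icc _ _ from ⟨by simpa using hR, hlarge⟩)
  have hsum : ∑ i, Q.pair (u i) (w i + (Pi.single k ((t : ℂ) • u k) : Fin l → H) i) =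
      x + (t : ℂ) • d := by
    simp only [map_add, Finset.sum_add_distrib, ← hx]
    rw [Finset.sum_eq_single k]
    · simp [hd]
    · intro i _ hi
      simp [hi]
    · simp
  refine ⟨fun i => w i + (Pi.single k ((t : ℂ) • u k) : Fin l → H) i, ?_, ?_⟩
  · rw [hsum, map_add, map_smul, hd, Pminus_pair]
    simp
  · rw [hsum]
    exact ht

end Pair

end HilbertTensorPower

/-- For `H` infinite dimensional and `l ≥ 2`:
`sup {r ≥ 1 : r·P₋V^{⊗2}_l ⊂ B₁} = 1` and `V^{∧2}_l = (√2·P₋V^{⊗2}_l) ∩ S₁`, i.e. the unit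
vectors of `H ∧ H` of Slater rank `≤ l` are exactly the unit-norm vectors `√2·P₋ξ` with `ξ` a
unit vector of `H ⊗ H` of Schmidt rank `≤ l`. -/
theorem stmt18 {H T : Type*} [NormedAddCommGroup H] [InnerProductSpace ℂ H] [CompleteSpace H]
    [NormedAddCommGroup T] [InnerProductSpace ℂ T] [CompleteSpace T]
    (hinf : ¬ FiniteDimensional ℂ H)
    (l : ℕ) (hl : 2 ≤ l) (Q : HilbertTensorPower 2 H T)
    (Vtl Vwl : Set T)
    (hVtl : Vtl = {ξ : T | ‖ξ‖ = 1 ∧ ∃ (c : Fin l → ℂ) (η : Fin l → Fin 2 → H),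
      (∀ i j, ‖η i j‖ = 1) ∧ ξ = ∑ i, c i • Q.tprod (η i)})
    (hVwl : Vwl = {ξ : T | ‖ξ‖ = 1 ∧ ∃ (c : Fin l → ℂ) (η : Fin l → Fin 2 → H),
      (∀ i, ‖Q.wedge (η i)‖ = 1) ∧ ξ = ∑ i, c i • Q.wedge (η i)}) :
    sSup {r : ℝ | 1 ≤ r ∧ ∀ ξ ∈ Vtl, ‖r • Q.Pminus ξ‖ ≤ 1} = 1 ∧
    Vwl = {ζ : T | (∃ ξ ∈ Vtl, ζ = (Real.sqrt 2 : ℂ) • Q.Pminus ξ) ∧ ‖ζ‖ = 1} := by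
  obtain ⟨e, f, he, hf, hef⟩ := HilbertTensorPower.exists_orthonormal_pair hinf
  have hnt : Nontrivial H := ⟨e, 0, by rintro rfl; simp at he⟩
  have hω := Q.norm_wedge_of_orthonormal he hf hef
  subst hVtl hVwl
  constructor
  · refine IsGreatest.csSup_eq ⟨⟨le_rfl, ?_⟩, ?_⟩
    · rintro ξ ⟨hξ, -⟩
      rw [one_smul, ← hξ]
      exact Q.norm_Pminus_le ξ
    · rintro r ⟨hr, h⟩
      have hw : Q.wedge ![e, f] =
          ∑ i : Fin l, Q.pair (if (i : ℕ) = 0 then e else if (i : ℕ) = 1 then f else 0)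
            (if (i : ℕ) = 0 then ((Real.sqrt 2 : ℂ) * 2⁻¹) • f
              else if (i : ℕ) = 1 then -((Real.sqrt 2 : ℂ) * 2⁻¹) • e else 0) := by
        obtain ⟨n, rfl⟩ := Nat.exists_eq_add_of_le' hl
        rw [Fin.sum_univ_succ, Fin.sum_univ_succ, Finset.sum_eq_zero (by intro i _; simp)]
        rw [Q.wedge_two]
        simp only [Matrix.cons_val_zero, Matrix.cons_val_one, Q.Pminus_pair]
        simp [smul_smul, sub_eq_add_neg]
      obtain ⟨c, η, hη, hs⟩ := Q.exists_sum_pair_eq_sum_smul_tprod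
        (fun i : Fin l => if (i : ℕ) = 0 then e else if (i : ℕ) = 1 then f else 0)
        (fun i : Fin l => if (i : ℕ) = 0 then ((Real.sqrt 2 : ℂ) * 2⁻¹) • f
              else if (i : ℕ) = 1 then -((Real.sqrt 2 : ℂ) * 2⁻¹) • e else 0)
      have hP : Q.Pminus (Q.wedge ![e, f]) = Q.wedge ![e, f] := by
        simp only [Q.wedge_two, map_smul, map_sub, Q.Pminus_pair]
        module
      have hle := h _ ⟨hω, c, η, hη, hw.trans hs⟩
      rw [hP, norm_smul, hω, mul_one] at hle
      exact (le_abs_self r).trans hle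
  · ext ζ
    constructor
    · rintro ⟨hζ, c, η, hη, rfl⟩
      have hsum : ∑ i, c i • Q.wedge (η i) =
          (Real.sqrt 2 : ℂ) • Q.Pminus (∑ i, Q.pair (η i 0) (c i • η i 1)) := by
        simp only [Q.wedge_two, map_sum, map_smul, Finset.smul_sum]
        exact Finset.sum_congr rfl fun i _ => smul_comm _ _ _
      have hk : η ⟨0, by omega⟩ 0 ≠ 0 := by
        intro h0
        have := hη ⟨0, by omega⟩
        rw [Q.wedge_two, h0] at this
        simp at this
      obtain ⟨w, hw, hwn⟩ := Q.exists_lift_norm_le (fun i => η i 0) (fun i => c i • η i 1)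
      rw [← hsum, hζ] at hwn
      obtain ⟨z, hz, hzn⟩ := Q.exists_lift_norm_eq (fun i => η i 0) w hwn hk
      obtain ⟨c', η', hη', hs⟩ := Q.exists_sum_pair_eq_sum_smul_tprod (fun i => η i 0) z
      refine ⟨⟨_, ⟨hzn, c', η', hη', hs⟩, ?_⟩, hζ⟩
      rw [hz, hw, hsum]
    · rintro ⟨⟨ξ, ⟨-, c, η, -, rfl⟩, rfl⟩, hζ⟩
      refine ⟨hζ, ?_⟩
      choose a θ hθ hw using fun i => Q.exists_wedge_eq_smul hω (c i • η i 0) (η i 1)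
      refine ⟨a, θ, hθ, ?_⟩
      rw [← Finset.sum_congr rfl fun i _ => hw i]
      simp only [Q.wedge_two, map_sum, map_smul, Finset.smul_sum, Q.tprod_eq_pair,
        Matrix.cons_val_zero, Matrix.cons_val_one, LinearMap.smul_apply]
end
end
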